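/- (Optimal invariance-abiding parameters recover the true posterior.) Let K ≥ 1, N ≥ 1, σ_y² > 0, let Σ ∈ ℝ^{K×K} be symmetric positive definite, let y₁, …, y_N ∈ ℝ, and write 𝟙 ∈ ℝ^K for the all-ones vector and ȳ := (1/N)Σ_{n=1}^N y_n. Take the invariance-abiding variational parameters λ* := (Kσ_y²/N)·𝟙 and m* := ȳ·𝟙, so that 𝟙ᵀλ* = K²σ_y²/N. Then the Gaussian density with precision matrix Λ_q := Σ⁻¹ + (1/(𝟙ᵀλ*))·𝟙𝟙ᵀ and mean μ_q := Λ_q⁻¹ · (1/(𝟙ᵀλ*))·𝟙𝟙ᵀ m* coincides with the true posterior: Λ_q⁻¹ = (N/(K²σ_y²)·𝟙𝟙ᵀ + Σ⁻¹)⁻¹ and μ_q = Λ_q⁻¹ · ((Σ_{n=1}^N y_n)/(Kσ_y²)) · 𝟙, i.e., N(·; μ_q, Λ_q⁻¹) is the normalized product of the prior N(·; 0, Σ) and the likelihoods ∏_n N(y_n; (1/K)𝟙ᵀw, σ_y²). -/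

import Mathlib

open MeasureTheory Matrix Real

/-- The multivariate Gaussian density `N(x; μ, S)` on `ℝ^m`. -/
noncomputable def gaussian {m : ℕ} (x μ : Fin m → ℝ) (S : Matrix (Fin m) (Fin m) ℝ) : ℝ :=
  (((2 * Real.pi) • S).det) ^ (-(1 : ℝ) / 2) *
    Real.exp (-(1 / 2) * ((x - μ) ⬝ᵥ (S⁻¹ *ᵥ (x - μ))))

/-- The one-dimensional Gaussian density `N(y; μ, σ²)`. -/
noncomputable def gaussian1 (y μ σ2 : ℝ) : ℝ :=
  (2 * Real.pi * σ2) ^ (-(1 : ℝ) / 2) * Real.exp (-(y - μ) ^ 2 / (2 * σ2))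

theorem integral_exp_neg_half_dotProduct_self (m : ℕ) :
    ∫ x : Fin m → ℝ, exp (-(1 / 2) * (x ⬝ᵥ x)) = √(2 * π) ^ m := by
  have h : ∀ x : Fin m → ℝ, exp (-(1 / 2) * (x ⬝ᵥ x)) = ∏ i, exp (-(1 / 2) * x i ^ 2) := by
    intro x
    rw [← exp_sum, dotProduct, Finset.mul_sum]
    simp only [sq]
  simp_rw [h]
  rw [integral_fintype_prod_volume_eq_pow (fun t : ℝ => exp (-(1 / 2) * t ^ 2)),
    integral_gaussian, Fintype.card_fin]
  congr 2
  ring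

theorem integral_comp_mulVec {m : ℕ} (B : Matrix (Fin m) (Fin m) ℝ) (hB : B.det ≠ 0)
    (f : (Fin m → ℝ) → ℝ) (hf : Continuous f) :
    ∫ x, f (B *ᵥ x) = |B.det|⁻¹ * ∫ x, f x := by
  have h := Real.map_matrix_volume_pi_eq_smul_volume_pi hB
  have hm : Measurable (toLin' B) := (LinearMap.continuous_on_pi _).measurable
  have h2 := integral_map (μ := volume) hm.aemeasurable
    (f := f) hf.aestronglyMeasurable
  rw [h, integral_smul_measure, ENNReal.toReal_ofReal (abs_nonneg _), abs_inv] at h2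
  simpa using h2.symm

open scoped MatrixOrder Matrix.Norms.L2Operator in
theorem exists_eq_transpose_mul_self {m : ℕ} {P : Matrix (Fin m) (Fin m) ℝ} (hP : P.PosDef) :
    ∃ B : Matrix (Fin m) (Fin m) ℝ, P = Bᵀ * B := by
  obtain ⟨B, hB⟩ := CStarAlgebra.nonneg_iff_eq_star_mul_self.mp hP.posSemidef.nonneg
  rw [star_eq_conjTranspose] at hB
  exact ⟨B, by simpa using hB⟩

theorem integral_gaussian_eq_one {m : ℕ} (μ : Fin m → ℝ) {S : Matrix (Fin m) (Fin m) ℝ}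
    (hS : S.PosDef) : ∫ x, gaussian x μ S = 1 := by
  obtain ⟨B, hB⟩ := exists_eq_transpose_mul_self hS.inv
  have hdet : S⁻¹.det = B.det ^ 2 := by rw [hB, det_mul, det_transpose, sq]
  have hB0 : B.det ≠ 0 := by
    have := hS.inv.det_pos
    rw [hdet] at this
    exact fun h => by simp [h] at this
  have hSdet : S.det = (B.det ^ 2)⁻¹ := by
    rw [← hdet, det_nonsing_inv, Ring.inverse_eq_inv', inv_inv]
  have hq : ∀ x : Fin m → ℝ, x ⬝ᵥ (S⁻¹ *ᵥ x) = (B *ᵥ x) ⬝ᵥ (B *ᵥ x) := by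
    intro x
    rw [hB, ← mulVec_mulVec, dotProduct_mulVec, vecMul_transpose]
  unfold gaussian
  rw [integral_const_mul,
    integral_sub_right_eq_self (fun x : Fin m → ℝ => exp (-(1 / 2) * (x ⬝ᵥ (S⁻¹ *ᵥ x)))) μ]
  simp_rw [hq]
  have hc : Continuous fun x : Fin m → ℝ => exp (-(1 / 2) * (x ⬝ᵥ x)) := by
    unfold dotProduct
    fun_prop
  rw [integral_comp_mulVec B hB0 _ hc, integral_exp_neg_half_dotProduct_self, det_smul,
    Fintype.card_fin, hSdet]
  have hpos : 0 < |B.det| := abs_pos.mpr hB0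
  have hs : 0 < √(2 * π) := by positivity
  have h1 : (2 * π) ^ m * (B.det ^ 2)⁻¹ = (√(2 * π) ^ m * |B.det|⁻¹) ^ 2 := by
    rw [mul_pow (√(2 * π) ^ m), ← pow_mul, mul_comm m 2, pow_mul, Real.sq_sqrt (by positivity), inv_pow, sq_abs]
  rw [h1, neg_div, Real.rpow_neg (by positivity), ← Real.sqrt_eq_rpow,
    Real.sqrt_sq (by positivity)]
  field_simp

theorem dotProduct_sub_mulVec_sub {m : ℕ} {P : Matrix (Fin m) (Fin m) ℝ} (hP : Pᵀ = P)
    (w μ : Fin m → ℝ) :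
    (w - μ) ⬝ᵥ (P *ᵥ (w - μ)) =
      w ⬝ᵥ (P *ᵥ w) - 2 * ((P *ᵥ μ) ⬝ᵥ w) + μ ⬝ᵥ (P *ᵥ μ) := by
  have h : μ ⬝ᵥ (P *ᵥ w) = (P *ᵥ μ) ⬝ᵥ w := by
    rw [dotProduct_mulVec, ← mulVec_transpose, hP]
  rw [mulVec_sub, sub_dotProduct, dotProduct_sub, dotProduct_sub, h, dotProduct_comm w (P *ᵥ μ)]
  ring

theorem prod_gaussian1 {N : ℕ} (y : Fin N → ℝ) (t σ2 : ℝ) :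
    ∏ n, gaussian1 (y n) t σ2 =
      ((2 * π * σ2) ^ (-(1 : ℝ) / 2)) ^ N *
        exp (-(1 / 2) * ((∑ n, y n ^ 2) / σ2 - 2 * t * (∑ n, y n) / σ2 + N * t ^ 2 / σ2)) := by
  unfold gaussian1
  rw [Finset.prod_mul_distrib, Finset.prod_const, Finset.card_univ, Fintype.card_fin, ← exp_sum]
  congr 2
  have h : ∀ n, -(y n - t) ^ 2 / (2 * σ2) =
      -(1 / 2) * (y n ^ 2 / σ2 - (2 * t / σ2) * y n + t ^ 2 / σ2) := by
    intro n
    by_cases hσ : σ2 = 0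
    · simp [hσ]
    · field_simp
      ring
  simp_rw [h]
  rw [← Finset.mul_sum, Finset.sum_add_distrib, Finset.sum_sub_distrib, ← Finset.mul_sum,
    ← Finset.sum_div]
  simp
  ring

theorem optimal_invariance_abiding_parameters
    (K N : ℕ) (hK : 1 ≤ K) (hN : 1 ≤ N)
    (σy2 : ℝ) (hσ : 0 < σy2)
    (S : Matrix (Fin K) (Fin K) ℝ) (hS : S.PosDef)
    (y : Fin N → ℝ)
    (ones : Fin K → ℝ) (hones : ones = fun _ => 1)
    (ybar : ℝ) (hybar : ybar = (∑ n, y n) / (N : ℝ))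
    (lamstar : Fin K → ℝ) (hlamstar : lamstar = ((K : ℝ) * σy2 / (N : ℝ)) • ones)
    (mstar : Fin K → ℝ) (hmstar : mstar = ybar • ones)
    (Λq : Matrix (Fin K) (Fin K) ℝ)
    (hΛq : Λq = S⁻¹ + (ones ⬝ᵥ lamstar)⁻¹ • Matrix.vecMulVec ones ones)
    (μq : Fin K → ℝ)
    (hμq : μq = Λq⁻¹ *ᵥ ((ones ⬝ᵥ lamstar)⁻¹ • (Matrix.vecMulVec ones ones *ᵥ mstar))) :
    ones ⬝ᵥ lamstar = (K : ℝ) ^ 2 * σy2 / (N : ℝ) ∧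
    Λq⁻¹ = (((N : ℝ) / ((K : ℝ) ^ 2 * σy2)) • Matrix.vecMulVec ones ones + S⁻¹)⁻¹ ∧
    μq = Λq⁻¹ *ᵥ (((∑ n, y n) / ((K : ℝ) * σy2)) • ones) ∧
    ∀ w : Fin K → ℝ,
      gaussian w μq Λq⁻¹ =
        gaussian w 0 S * (∏ n, gaussian1 (y n) ((1 / (K : ℝ)) * (ones ⬝ᵥ w)) σy2) /
          (∫ w' : Fin K → ℝ,
            gaussian w' 0 S * ∏ n, gaussian1 (y n) ((1 / (K : ℝ)) * (ones ⬝ᵥ w')) σy2) := by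
  have hK0 : (K : ℝ) ≠ 0 := by positivity
  have hN0 : (N : ℝ) ≠ 0 := by positivity
  have hoo : ones ⬝ᵥ ones = (K : ℝ) := by simp [hones, dotProduct]
  have hlam : ones ⬝ᵥ lamstar = (K : ℝ) ^ 2 * σy2 / (N : ℝ) := by
    rw [hlamstar, dotProduct_smul, hoo, smul_eq_mul]
    ring
  have hv : ∀ w : Fin K → ℝ, vecMulVec ones ones *ᵥ w = (ones ⬝ᵥ w) • ones := by
    intro w
    rw [vecMulVec_mulVec, op_smul_eq_smul]
  rw [hlam, inv_div] at hΛq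
  have hμ : μq = Λq⁻¹ *ᵥ (((∑ n, y n) / ((K : ℝ) * σy2)) • ones) := by
    rw [hμq, hlam, hv, smul_smul, hmstar, dotProduct_smul, hoo, hybar, smul_eq_mul]
    congr 2
    field_simp
  refine ⟨hlam, by rw [hΛq, add_comm], hμ, ?_⟩
  have hJ : (((N : ℝ) / ((K : ℝ) ^ 2 * σy2)) • vecMulVec ones ones).PosSemidef := by
    refine PosSemidef.smul ?_ (by positivity)
    simpa using posSemidef_vecMulVec_self_star ones
  have hΛ : Λq.PosDef := hΛq ▸ hS.inv.add_posSemidef hJ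
  have hΛu : IsUnit Λq.det := (isUnit_iff_isUnit_det _).mp hΛ.isUnit
  have hΛT : Λqᵀ = Λq := by simpa using hΛ.isHermitian.eq
  have hΛμ : Λq *ᵥ μq = ((∑ n, y n) / ((K : ℝ) * σy2)) • ones := by
    rw [hμ, mulVec_mulVec, mul_nonsing_inv _ hΛu, one_mulVec]
  have hnorm : ∀ {T : Matrix (Fin K) (Fin K) ℝ}, T.PosDef →
      0 < (((2 * π) • T).det) ^ (-(1 : ℝ) / 2) := fun hT =>
    rpow_pos_of_pos (hT.smul (by positivity)).det_pos _
  obtain ⟨c, hc, h⟩ : ∃ c : ℝ, c ≠ 0 ∧ ∀ w : Fin K → ℝ,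
      gaussian w 0 S * (∏ n, gaussian1 (y n) ((1 / (K : ℝ)) * (ones ⬝ᵥ w)) σy2) =
        c * gaussian w μq Λq⁻¹ := by
    have hA := hnorm hS
    have hA' := hnorm hΛ.inv
    refine ⟨(((2 * π) • S).det) ^ (-(1 : ℝ) / 2) / (((2 * π) • Λq⁻¹).det) ^ (-(1 : ℝ) / 2) *
      ((2 * π * σy2) ^ (-(1 : ℝ) / 2)) ^ N *
      exp (-(1 / 2) * ((∑ n, y n ^ 2) / σy2 - μq ⬝ᵥ (Λq *ᵥ μq))), by positivity, fun w => ?_⟩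
    have hexp : exp (-(1 / 2) * (w ⬝ᵥ (S⁻¹ *ᵥ w))) *
        exp (-(1 / 2) * ((∑ n, y n ^ 2) / σy2 - 2 * (1 / (K : ℝ) * (ones ⬝ᵥ w)) * (∑ n, y n) / σy2
          + N * (1 / (K : ℝ) * (ones ⬝ᵥ w)) ^ 2 / σy2)) =
        exp (-(1 / 2) * ((∑ n, y n ^ 2) / σy2 - μq ⬝ᵥ (Λq *ᵥ μq))) *
        exp (-(1 / 2) * ((w - μq) ⬝ᵥ (Λq *ᵥ (w - μq)))) := by
      rw [← exp_add, ← exp_add, dotProduct_sub_mulVec_sub hΛT]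
      have hw : w ⬝ᵥ (Λq *ᵥ w) =
          w ⬝ᵥ (S⁻¹ *ᵥ w) + (N : ℝ) / ((K : ℝ) ^ 2 * σy2) * (ones ⬝ᵥ w) ^ 2 := by
        rw [hΛq, add_mulVec, smul_mulVec, hv, dotProduct_add, dotProduct_smul, dotProduct_smul,
          dotProduct_comm w ones, smul_eq_mul, smul_eq_mul]
        ring
      have hl : (Λq *ᵥ μq) ⬝ᵥ w = (∑ n, y n) / ((K : ℝ) * σy2) * (ones ⬝ᵥ w) := by
        rw [hΛμ, smul_dotProduct, smul_eq_mul]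
      rw [hw, hl]
      congr 1
      field_simp
      ring
    rw [prod_gaussian1]
    unfold gaussian
    rw [nonsing_inv_nonsing_inv _ hΛu, sub_zero, mul_mul_mul_comm, hexp]
    have hA'0 := hA'.ne'
    generalize (((2 * π) • Λq⁻¹).det) ^ (-(1 : ℝ) / 2) = a at hA'0 ⊢
    field_simp
  intro w
  simp_rw [h]
  rw [integral_const_mul, integral_gaussian_eq_one μq hΛ.inv, mul_one, mul_div_cancel_left₀ _ hc]
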